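/- Suppose Λ is connected as a nearest-neighbor graph, ε_0 > 0 at a distinguished site 0 ∈ Λ, and ε_j = 0 for j ≠ 0. Then for every t ∈ ℝ^Λ the matrix A is invertible and for every x ∈ Λ one has ε_0 e^{t_0} · (A^{-1})_{0x} = 1, i.e. (A^{-1})_{0x} = 1/(ε_0 e^{t_0}). -/

import Mathlib

open Real MeasureTheory Finset

noncomputable section

/-- Squared Euclidean distance between two points of `ℤ^d`;
`eSq j k = 1` means `j` and `k` are nearest neighbours. -/
def eSq {d : ℕ} (j k : Fin d → ℤ) : ℤ := ∑ i, (j i - k i) ^ 2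

/-- Euclidean (lattice) distance between two points of `ℤ^d`. -/
def latDist {d : ℕ} (x y : Fin d → ℤ) : ℝ :=
  Real.sqrt (∑ i, ((x i : ℝ) - (y i : ℝ)) ^ 2)

/-- Kinetic term `F_Λ(∇t) = β Σ_{(jj')} (cosh(t_j - t_{j'}) - 1)`;
each unordered nearest-neighbour pair of `Λ` is counted once. -/
def Fkin {d : ℕ} (Λ : Finset (Fin d → ℤ)) (β : ℝ) (t : (Fin d → ℤ) → ℝ) : ℝ :=
  β / 2 * ∑ j ∈ Λ, ∑ k ∈ Λ.filter (fun k => eSq j k = 1), (Real.cosh (t j - t k) - 1)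

/-- Mass term `M^ε_Λ(t) = Σ_j ε_j (cosh t_j - 1)`. -/
def Mmass {d : ℕ} (Λ : Finset (Fin d → ℤ)) (ε : (Fin d → ℤ) → ℝ)
    (t : (Fin d → ℤ) → ℝ) : ℝ :=
  ∑ j ∈ Λ, ε j * (Real.cosh (t j) - 1)

/-- `V_j = Σ_{k ∈ Λ, |k-j|=1} (e^{t_k - t_j} - 1)`. -/
def Vpot {d : ℕ} (Λ : Finset (Fin d → ℤ)) (t : (Fin d → ℤ) → ℝ) (j : Fin d → ℤ) : ℝ :=
  ∑ k ∈ Λ.filter (fun k => eSq j k = 1), (Real.exp (t k - t j) - 1)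

/-- The matrix `D^ε_Λ(t)`:  `D_{ij} = 0` if `|i-j| > 1`, `D_{ij} = -β` if `|i-j| = 1`,
`D_{jj} = β(2d + V_j) + ε_j e^{-t_j}`. -/
def Dmat {d : ℕ} (Λ : Finset (Fin d → ℤ)) (β : ℝ) (ε : (Fin d → ℤ) → ℝ)
    (t : (Fin d → ℤ) → ℝ) : Matrix {z // z ∈ Λ} {z // z ∈ Λ} ℝ := fun i j =>
  if eSq i.1 j.1 = 1 then -β
  else if i = j then β * (2 * (d : ℝ) + Vpot Λ t j.1) + ε j.1 * Real.exp (-t j.1)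
  else 0

/-- Extension of a configuration `t ∈ ℝ^Λ` by `0` outside `Λ`
(the model only ever uses the values on `Λ`). -/
def extend0 {d : ℕ} (Λ : Finset (Fin d → ℤ)) (t : {z // z ∈ Λ} → ℝ) :
    (Fin d → ℤ) → ℝ :=
  fun z => if h : z ∈ Λ then t ⟨z, h⟩ else 0

/-- Density of the measure `dμ^ε_Λ` with respect to Lebesgue measure on `ℝ^Λ`:
`Π_j (1/√(2π)) · e^{-F_Λ(∇t)} · e^{-M^ε_Λ(t)} · √(det D^ε_Λ(t))`. -/
def dens {d : ℕ} (Λ : Finset (Fin d → ℤ)) (β : ℝ) (ε : (Fin d → ℤ) → ℝ)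
    (t : {z // z ∈ Λ} → ℝ) : ℝ :=
  (Real.sqrt (2 * π))⁻¹ ^ Λ.card * Real.exp (-Fkin Λ β (extend0 Λ t)) *
    Real.exp (-Mmass Λ ε (extend0 Λ t)) *
    Real.sqrt (Dmat Λ β ε (extend0 Λ t)).det

/-- The one-site integral `I_β = √(β/(2π)) ∫_ℝ e^{-β(cosh t - 1)} dt`. -/
def Ibeta (β : ℝ) : ℝ :=
  Real.sqrt (β / (2 * π)) * ∫ t : ℝ, Real.exp (-β * (Real.cosh t - 1))

/-- `Λ` is connected as a nearest-neighbour graph. -/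
def latticeConn {d : ℕ} (Λ : Finset (Fin d → ℤ)) : Prop :=
  ∀ x ∈ Λ, ∀ y ∈ Λ,
    Relation.ReflTransGen (fun a b => a ∈ Λ ∧ b ∈ Λ ∧ eSq a b = 1) x y

variable {d : ℕ}

/-- The conjugated matrix `A = e^t D e^t` with a single pinning `ε₀ e^{t_0}` at the
origin: `A_{ij} = 0` if `|i-j| > 1`, `A_{ij} = -β e^{t_i+t_j}` if `|i-j| = 1`,
`A_{ii} = β Σ_{i'~i} e^{t_i+t_{i'}}` for `i ≠ 0`, and
`A_{00} = β Σ_{i'~0} e^{t_0+t_{i'}} + ε₀ e^{t_0}`. -/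
def Amat (Λ : Finset (Fin d → ℤ)) (β ε₀ : ℝ) (t : (Fin d → ℤ) → ℝ) :
    Matrix {z // z ∈ Λ} {z // z ∈ Λ} ℝ := fun i j =>
  if eSq i.1 j.1 = 1 then -β * Real.exp (t i.1 + t j.1)
  else if i = j then
    β * ∑ k ∈ Λ.filter (fun k => eSq i.1 k = 1), Real.exp (t i.1 + t k)
      + (if i.1 = 0 then ε₀ * Real.exp (t i.1) else 0)
  else 0

theorem eSq_comm (x y : Fin d → ℤ) : eSq x y = eSq y x :=
  Finset.sum_congr rfl fun i _ => by ring

theorem eSq_self (x : Fin d → ℤ) : eSq x x = 0 := by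
  simp [eSq]

/-- Conductance `β e^{t_x + t_y}` of the edge `xy`, and `0` if `x`, `y` are not neighbours. -/
def conductance (β : ℝ) (t : (Fin d → ℤ) → ℝ) (x y : Fin d → ℤ) : ℝ :=
  if eSq x y = 1 then β * Real.exp (t x + t y) else 0

theorem conductance_comm (β : ℝ) (t : (Fin d → ℤ) → ℝ) (x y : Fin d → ℤ) :
    conductance β t x y = conductance β t y x := by
  simp only [conductance, eSq_comm x y, add_comm (t x)]

theorem conductance_nonneg {β : ℝ} (hβ : 0 ≤ β) (t : (Fin d → ℤ) → ℝ) (x y : Fin d → ℤ) :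
    0 ≤ conductance β t x y := by
  unfold conductance
  split_ifs <;> positivity

theorem sum_mul_sum_weighted_sub {ι : Type*} [Fintype ι] (w : ι → ι → ℝ)
    (hw : ∀ i j, w i j = w j i) (v : ι → ℝ) :
    ∑ i, v i * ∑ j, w i j * (v i - v j) = (∑ i, ∑ j, w i j * (v i - v j) ^ 2) / 2 := by
  have hswap : ∑ i, ∑ j, v i * (w i j * (v i - v j)) =
      ∑ i, ∑ j, v j * (w i j * (v j - v i)) := by
    rw [Finset.sum_comm]
    simp only [hw]
  have hadd : ∑ i, ∑ j, w i j * (v i - v j) ^ 2 =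
      ∑ i, ∑ j, v i * (w i j * (v i - v j)) + ∑ i, ∑ j, v j * (w i j * (v j - v i)) := by
    simp only [← Finset.sum_add_distrib]
    exact Finset.sum_congr rfl fun i _ => Finset.sum_congr rfl fun j _ => by ring
  simp only [Finset.mul_sum]
  linarith

theorem Amat_isSymm (Λ : Finset (Fin d → ℤ)) (β ε₀ : ℝ) (t : (Fin d → ℤ) → ℝ) :
    (Amat Λ β ε₀ t).IsSymm := by
  ext i j
  by_cases hij : i = j
  · rw [hij, Matrix.transpose_apply]
  · simp only [Matrix.transpose_apply, Amat, eSq_comm j.1, add_comm (t j.1), hij, Ne.symm hij,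
      if_false]

theorem Amat_apply (Λ : Finset (Fin d → ℤ)) (β ε₀ : ℝ) (t : (Fin d → ℤ) → ℝ)
    (i j : {z // z ∈ Λ}) :
    Amat Λ β ε₀ t i j = -conductance β t i.1 j.1 +
      if i = j then ∑ k : {z // z ∈ Λ}, conductance β t i.1 k.1 +
        (if i.1 = 0 then ε₀ * Real.exp (t 0) else 0) else 0 := by
  by_cases hij : i = j
  · subst hij
    have hsum : ∑ k : {z // z ∈ Λ}, conductance β t i.1 k.1 =
        β * ∑ k ∈ Λ.filter (fun k => eSq i.1 k = 1), Real.exp (t i.1 + t k) := by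
      rw [Finset.sum_coe_sort Λ (fun k => conductance β t i.1 k), Finset.sum_filter,
        Finset.mul_sum]
      simp only [conductance, mul_ite, mul_zero]
    have hself : conductance β t i.1 i.1 = 0 := by simp [conductance, eSq_self]
    rw [hsum, hself]
    simp only [Amat, eSq_self, if_true, zero_ne_one, if_false, neg_zero, zero_add]
    split_ifs with h0
    · rw [h0]
    · rfl
  · simp only [Amat, hij, conductance, if_false, add_zero]
    split_ifs <;> ring

theorem Amat_mulVec (Λ : Finset (Fin d → ℤ)) (β ε₀ : ℝ) (t : (Fin d → ℤ) → ℝ)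
    (v : {z // z ∈ Λ} → ℝ) (i : {z // z ∈ Λ}) :
    (Amat Λ β ε₀ t).mulVec v i = ∑ j, conductance β t i.1 j.1 * (v i - v j) +
      (if i.1 = 0 then ε₀ * Real.exp (t 0) else 0) * v i := by
  simp only [Matrix.mulVec, dotProduct, Amat_apply, add_mul, ite_mul, zero_mul,
    Finset.sum_add_distrib, Finset.sum_ite_eq, Finset.mem_univ, if_true, mul_sub,
    Finset.sum_sub_distrib, Finset.sum_mul, neg_mul, Finset.sum_neg_distrib]
  ring

theorem dotProduct_Amat_mulVec (Λ : Finset (Fin d → ℤ)) (β ε₀ : ℝ) (t : (Fin d → ℤ) → ℝ)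
    (h0 : (0 : Fin d → ℤ) ∈ Λ) (v : {z // z ∈ Λ} → ℝ) :
    ∑ i, v i * (Amat Λ β ε₀ t).mulVec v i =
      (∑ i : {z // z ∈ Λ}, ∑ j : {z // z ∈ Λ},
        conductance β t i.1 j.1 * (v i - v j) ^ 2) / 2 +
      ε₀ * Real.exp (t 0) * v ⟨0, h0⟩ ^ 2 := by
  have hpin : ∑ i : {z // z ∈ Λ},
      v i * ((if i.1 = 0 then ε₀ * Real.exp (t 0) else 0) * v i) =
        ε₀ * Real.exp (t 0) * v ⟨0, h0⟩ ^ 2 := by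
    rw [Finset.sum_eq_single_of_mem ⟨0, h0⟩ (Finset.mem_univ _)]
    · rw [if_pos rfl]
      ring
    · intro i _ hi
      rw [if_neg fun h => hi (Subtype.ext h)]
      ring
  simp only [Amat_mulVec, mul_add, Finset.sum_add_distrib, hpin]
  rw [sum_mul_sum_weighted_sub (fun i j : {z // z ∈ Λ} => conductance β t i.1 j.1)
    (fun _ _ => conductance_comm ..)]

theorem eq_zero_of_Amat_mulVec_eq_zero {β ε₀ : ℝ} (hβ : 0 < β) (hε₀ : 0 < ε₀)
    {Λ : Finset (Fin d → ℤ)} (hconn : latticeConn Λ) (h0 : (0 : Fin d → ℤ) ∈ Λ)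
    (t : (Fin d → ℤ) → ℝ) {v : {z // z ∈ Λ} → ℝ} (hv : (Amat Λ β ε₀ t).mulVec v = 0) :
    v = 0 := by
  have hform := dotProduct_Amat_mulVec Λ β ε₀ t h0 v
  simp only [hv, Pi.zero_apply, mul_zero, Finset.sum_const_zero] at hform
  have hterm (i j : {z // z ∈ Λ}) : 0 ≤ conductance β t i.1 j.1 * (v i - v j) ^ 2 :=
    mul_nonneg (conductance_nonneg hβ.le ..) (sq_nonneg _)
  have hrow (i : {z // z ∈ Λ}) :
      0 ≤ ∑ j : {z // z ∈ Λ}, conductance β t i.1 j.1 * (v i - v j) ^ 2 :=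
    Finset.sum_nonneg fun j _ => hterm i j
  have hsum : 0 ≤ ∑ i : {z // z ∈ Λ}, ∑ j : {z // z ∈ Λ},
      conductance β t i.1 j.1 * (v i - v j) ^ 2 := Finset.sum_nonneg fun i _ => hrow i
  have hpos : 0 < ε₀ * Real.exp (t 0) := by positivity
  have hpin : 0 ≤ ε₀ * Real.exp (t 0) * v ⟨0, h0⟩ ^ 2 := by positivity
  have hv0 : v ⟨0, h0⟩ = 0 := by
    have : ε₀ * Real.exp (t 0) * v ⟨0, h0⟩ ^ 2 = 0 := by linarith
    simpa [hpos.ne'] using this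
  have hedge (i j : {z // z ∈ Λ}) (hij : eSq i.1 j.1 = 1) : v i = v j := by
    have hrow0 := (Finset.sum_eq_zero_iff_of_nonneg fun i _ => hrow i).1
      (by linarith) i (Finset.mem_univ _)
    have hterm0 := (Finset.sum_eq_zero_iff_of_nonneg fun j _ => hterm i j).1
      hrow0 j (Finset.mem_univ _)
    rw [conductance, if_pos hij] at hterm0
    have hw : 0 < β * Real.exp (t i.1 + t j.1) := by positivity
    simpa [hw.ne', sub_eq_zero] using hterm0
  have hpath (x : Fin d → ℤ)
      (hx : Relation.ReflTransGen (fun a b => a ∈ Λ ∧ b ∈ Λ ∧ eSq a b = 1) 0 x) :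
      ∀ hxΛ : x ∈ Λ, v ⟨x, hxΛ⟩ = 0 := by
    induction hx with
    | refl => exact fun _ => hv0
    | tail _ hbc ih =>
      exact fun hc => (hedge ⟨_, hbc.1⟩ ⟨_, hc⟩ hbc.2.2).symm.trans (ih hbc.1)
  exact funext fun i => hpath i.1 (hconn 0 h0 i.1 i.2) i.2

theorem isUnit_det_Amat {β ε₀ : ℝ} (hβ : 0 < β) (hε₀ : 0 < ε₀)
    {Λ : Finset (Fin d → ℤ)} (hconn : latticeConn Λ) (h0 : (0 : Fin d → ℤ) ∈ Λ)
    (t : (Fin d → ℤ) → ℝ) : IsUnit (Amat Λ β ε₀ t).det := by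
  rw [isUnit_iff_ne_zero]
  intro hdet
  obtain ⟨v, hv, hAv⟩ := Matrix.exists_mulVec_eq_zero_iff.2 hdet
  exact hv (eq_zero_of_Amat_mulVec_eq_zero hβ hε₀ hconn h0 t hAv)

theorem Amat_mulVec_one (Λ : Finset (Fin d → ℤ)) (β ε₀ : ℝ) (t : (Fin d → ℤ) → ℝ)
    (h0 : (0 : Fin d → ℤ) ∈ Λ) :
    (Amat Λ β ε₀ t).mulVec 1 = Pi.single ⟨0, h0⟩ (ε₀ * Real.exp (t 0)) := by
  ext i
  simp [Amat_mulVec, Pi.single_apply, Subtype.ext_iff]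

/-- If `Λ` is connected with a single pinning `ε₀ > 0` at `0 ∈ Λ`, then `A` is
invertible and `(A⁻¹)_{0x} = 1/(ε₀ e^{t_0})` for every `x ∈ Λ`. -/
theorem pinned_laplacian_inverse_row
    (hd : 1 ≤ d) (β : ℝ) (hβ : 0 < β) (ε₀ : ℝ) (hε₀ : 0 < ε₀)
    (Λ : Finset (Fin d → ℤ)) (hconn : latticeConn Λ)
    (h0 : (0 : Fin d → ℤ) ∈ Λ) (t : (Fin d → ℤ) → ℝ) :
    IsUnit (Amat Λ β ε₀ t).det ∧
      ∀ (x : Fin d → ℤ) (hx : x ∈ Λ),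
        (Amat Λ β ε₀ t)⁻¹ ⟨(0 : Fin d → ℤ), h0⟩ ⟨x, hx⟩
          = 1 / (ε₀ * Real.exp (t 0)) := by
  have hunit := isUnit_det_Amat hβ hε₀ hconn h0 t
  refine ⟨hunit, fun x hx => ?_⟩
  have hinv := congrFun (congrArg ((Amat Λ β ε₀ t)⁻¹.mulVec) (Amat_mulVec_one Λ β ε₀ t h0)) ⟨x, hx⟩
  rw [Matrix.mulVec_mulVec, Matrix.nonsing_inv_mul _ hunit, Matrix.one_mulVec,
    Matrix.mulVec_single] at hinv
  have hsymm : (Amat Λ β ε₀ t)⁻¹ ⟨0, h0⟩ ⟨x, hx⟩ = (Amat Λ β ε₀ t)⁻¹ ⟨x, hx⟩ ⟨0, h0⟩ :=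
    (Amat_isSymm Λ β ε₀ t).inv.apply ⟨x, hx⟩ ⟨0, h0⟩
  have hpos : 0 < ε₀ * Real.exp (t 0) := by positivity
  rw [hsymm, eq_div_iff hpos.ne']
  simpa using hinv.symm

end
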